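/- arXiv:1010.2935 — 6 statements merged into one kernel-verified Lean document; each statement's English description precedes it below -/
import Mathlib

section
/- Let Γ be the subgroup of the multiplicative group ℂ* generated by the two real numbers e and e^{−π}, acting on ℂ \ {0} by multiplication. Then for every nonempty open Γ-invariant subset U ⊆ ℂ \ {0}, the orbit space U/Γ, endowed with the quotient topology, is not Hausdorff. -/
open Complex

/-- The subgroup `Γ = {e^(m + n·π) : m, n ∈ ℤ}` of `ℂ*` acting by multiplication:
orbit equivalence relation on a subset `U` of `ℂ`. -/
def gammaSetoid (U : Set ℂ) : Setoid ↥U where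
  r x y := ∃ m n : ℤ, (y : ℂ) = Complex.exp ((m : ℂ) + (n : ℂ) * (Real.pi : ℂ)) * (x : ℂ)
  iseqv := by
    refine ⟨fun x => ⟨0, 0, by simp⟩, ?_, ?_⟩
    · rintro x y ⟨m, n, h⟩
      refine ⟨-m, -n, ?_⟩
      have key : ((-m : ℤ) : ℂ) + ((-n : ℤ) : ℂ) * (Real.pi : ℂ)
          + (((m : ℤ) : ℂ) + ((n : ℤ) : ℂ) * (Real.pi : ℂ)) = 0 := by push_cast; ring
      rw [h, ← mul_assoc, ← Complex.exp_add, key, Complex.exp_zero, one_mul]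
    · rintro x y z ⟨m, n, h₁⟩ ⟨m', n', h₂⟩
      refine ⟨m' + m, n' + n, ?_⟩
      rw [h₂, h₁, ← mul_assoc, ← Complex.exp_add]
      push_cast
      ring_nf

/-- The set `ℤ + ℤπ` is dense in `ℝ`. -/
theorem dense_int_add_int_mul_pi : Dense {t : ℝ | ∃ m n : ℤ, t = m + n * Real.pi} := by
  have h : Dense (AddSubgroup.closure {Real.pi, 1} : Set ℝ) :=
    dense_addSubgroupClosure_pair_iff.2 (by simp)
  refine h.mono fun t ht => ?_
  obtain ⟨n, m, rfl⟩ := AddSubgroup.mem_closure_pair.1 ht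
  exact ⟨m, n, by simp [add_comm]⟩

theorem half_ne_int_add_int_mul_pi (m n : ℤ) : (1 / 2 : ℝ) ≠ m + n * Real.pi := by
  intro h
  rcases eq_or_ne n 0 with rfl | hn
  · have h2 : ((2 * m : ℤ) : ℝ) = (1 : ℤ) := by push_cast at h ⊢; linarith
    have := Int.cast_injective h2
    omega
  · refine ((irrational_pi.intCast_mul hn).intCast_add m) ⟨1 / 2, ?_⟩
    push_cast
    exact h

/-- For the action of the multiplicative group generated by `e` and `e^(-π)` on `ℂ \ {0}`,
no nonempty open invariant subset has a Hausdorff orbit space. -/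
theorem stmt0 (U : Set ℂ) (hne : U.Nonempty) (hopen : IsOpen U)
    (hsub : ∀ z ∈ U, z ≠ 0)
    (hinv : ∀ (m n : ℤ), ∀ z ∈ U,
      Complex.exp ((m : ℂ) + (n : ℂ) * (Real.pi : ℂ)) * z ∈ U) :
    ¬ T2Space (Quotient (gammaSetoid U)) := by
  intro hT
  obtain ⟨z, hz⟩ := hne
  have hcont : Continuous fun t : ℝ => Complex.exp (t : ℂ) * z := by fun_prop
  have hmem : ∀ t : ℝ, Complex.exp (t : ℂ) * z ∈ U := by
    intro t
    obtain ⟨_, ⟨m, n, rfl⟩, hg⟩ := dense_int_add_int_mul_pi.exists_mem_open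
      (hopen.preimage (hcont.comp (continuous_sub_left t)))
      ⟨t, by simpa using hz⟩
    have hg' := hinv m n _ hg
    simp only [Function.comp_apply, ← mul_assoc, ← Complex.exp_add] at hg'
    simpa using hg'
  let f : ℝ → Quotient (gammaSetoid U) := fun t => Quotient.mk _ ⟨_, hmem t⟩
  have hf : Continuous f := continuous_quotient_mk'.comp (hcont.subtype_mk hmem)
  have hconst : f = fun _ => f 0 := by
    refine hf.ext_on dense_int_add_int_mul_pi continuous_const ?_
    rintro _ ⟨m, n, rfl⟩
    exact (Quotient.sound (s := gammaSetoid U) ⟨m, n, by simp⟩).symm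
  obtain ⟨m, n, h⟩ := Quotient.exact (congrFun hconst (1 / 2)).symm
  have h' : Complex.exp ((1 / 2 : ℝ) : ℂ) = Complex.exp ((m + n * Real.pi : ℝ) : ℂ) := by
    refine mul_right_cancel₀ (hsub z hz) ?_
    simpa using h
  rw [← Complex.ofReal_exp, ← Complex.ofReal_exp] at h'
  exact half_ne_int_add_int_mul_pi m n (Real.exp_injective (Complex.ofReal_injective h'))
end

section
/- For every a ∈ ℂ \ {0}, the ℂ-action on the quadric X is transitive on the fibre {(x, y, z) ∈ X : z = a}: for any two points p, q ∈ X whose third coordinate equals a, there exists t ∈ ℂ with t • p = q. -/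
/-- The affine quadric `X = {(x, y, z) ∈ ℂ³ : x² + y·z = 1}`. -/
def Xq : Set (ℂ × ℂ × ℂ) := {p | p.1 ^ 2 + p.2.1 * p.2.2 = 1}

/-- The action of the additive group `(ℂ, +)` on `ℂ³`:
`t • (x, y, z) = (x + t·z, y − 2·t·x − t²·z, z)`. -/
def act (t : ℂ) (p : ℂ × ℂ × ℂ) : ℂ × ℂ × ℂ :=
  (p.1 + t * p.2.2, p.2.1 - 2 * t * p.1 - t ^ 2 * p.2.2, p.2.2)

lemma act_zero (p : ℂ × ℂ × ℂ) : act 0 p = p := by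
  simp [act]

lemma act_add (s t : ℂ) (p : ℂ × ℂ × ℂ) : act (s + t) p = act s (act t p) := by
  simp only [act, Prod.mk.injEq]
  exact ⟨by ring, by ring, trivial⟩

/-- The orbit equivalence relation of the `ℂ`-action `act` on a subset `S ⊆ ℂ³`. -/
def actSetoid (S : Set (ℂ × ℂ × ℂ)) : Setoid ↥S where
  r p q := ∃ t : ℂ, act t (p : ℂ × ℂ × ℂ) = q
  iseqv := by
    refine ⟨fun p => ⟨0, act_zero _⟩, ?_, ?_⟩
    · rintro p q ⟨t, ht⟩
      exact ⟨-t, by rw [← ht, ← act_add]; simp [act_zero]⟩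
    · rintro p q r ⟨t, ht⟩ ⟨s, hs⟩
      exact ⟨s + t, by rw [act_add, ht, hs]⟩

/-- For `a ≠ 0` the `ℂ`-action is transitive on the fibre `{p ∈ X : z = a}`. -/
theorem stmt4 (a : ℂ) (ha : a ≠ 0) (p q : ℂ × ℂ × ℂ) (hp : p ∈ Xq) (hq : q ∈ Xq)
    (hpa : p.2.2 = a) (hqa : q.2.2 = a) :
    ∃ t : ℂ, act t p = q := by
  obtain ⟨x, y, z⟩ := p
  obtain ⟨x', y', z'⟩ := q
  simp only [Xq, Set.mem_ofPred_eq] at hp hq hpa hqa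
  subst hpa hqa
  have ht : (x' - x) / z' * z' = x' - x := div_mul_cancel₀ _ ha
  refine ⟨(x' - x) / z', ?_⟩
  generalize (x' - x) / z' = t at ht
  simp only [act, Prod.mk.injEq, and_true]
  refine ⟨by linear_combination ht, mul_right_cancel₀ ha ?_⟩
  linear_combination hp - hq - (t * z' + x' + x) * ht
end

section
/- Every ℂ-invariant open subset V ⊆ X containing the point (1, 0, 0) intersects every open subset of X containing the point (−1, 0, 0). In particular, the orbit space X/ℂ, endowed with the quotient topology, is not Hausdorff: the orbits of (1, 0, 0) and (−1, 0, 0) are distinct but cannot be separated by disjoint open sets in the quotient. -/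
lemma p1_mem : ((1 : ℂ), (0 : ℂ), (0 : ℂ)) ∈ Xq := by norm_num [Xq]

lemma p2_mem : ((-1 : ℂ), (0 : ℂ), (0 : ℂ)) ∈ Xq := by norm_num [Xq]

lemma act_mem_Xq {p : ℂ × ℂ × ℂ} (hp : p ∈ Xq) (t : ℂ) : act t p ∈ Xq := by
  simp only [Xq, act, Set.mem_ofPred_eq] at hp ⊢
  linear_combination hp

/-- The points `(±1, 0, e)` of the quadric lie on a common orbit when `e ≠ 0`. -/
lemma act_neg_two_div {e : ℂ} (he : e ≠ 0) : act (-2 / e) (1, 0, e) = (-1, 0, e) := by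
  simp only [act, Prod.mk.injEq, and_true]
  constructor
  · field_simp
    norm_num
  · field_simp
    ring

/-- Near `(c, 0, 0)` with `c² = 1`, a relatively open subset of the quadric contains all `(c, 0, e)`
with `e` small. -/
lemma eventually_mem_of_isOpen_preimage {V : Set (ℂ × ℂ × ℂ)}
    (hV : IsOpen (Subtype.val ⁻¹' V : Set ↥Xq)) {c : ℂ} (hc : c ^ 2 = 1) (h : (c, 0, 0) ∈ V) :
    ∀ᶠ e : ℂ in nhds 0, (c, 0, e) ∈ V := by
  let f : ℂ → ↥Xq := fun e => ⟨(c, 0, e), by simp [Xq, hc]⟩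
  have hf : Continuous f := by fun_prop
  exact (hV.preimage hf).mem_nhds h

lemma inter_nonempty_of_invariant {V W : Set (ℂ × ℂ × ℂ)}
    (hV : IsOpen (Subtype.val ⁻¹' V : Set ↥Xq)) (hinv : ∀ t : ℂ, ∀ p ∈ V, act t p ∈ V)
    (h1 : ((1 : ℂ), (0 : ℂ), (0 : ℂ)) ∈ V) (hW : IsOpen (Subtype.val ⁻¹' W : Set ↥Xq))
    (h2 : ((-1 : ℂ), (0 : ℂ), (0 : ℂ)) ∈ W) : (V ∩ W).Nonempty := by
  have hVe := eventually_mem_of_isOpen_preimage hV (by norm_num) h1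
  have hWe := eventually_mem_of_isOpen_preimage hW (by norm_num) h2
  obtain ⟨e, ⟨heV, heW⟩, he⟩ :=
    (((hVe.and hWe).filter_mono nhdsWithin_le_nhds).and
      (self_mem_nhdsWithin : {(0 : ℂ)}ᶜ ∈ nhdsWithin (0 : ℂ) {0}ᶜ)).exists
  exact ⟨(-1, 0, e), act_neg_two_div he ▸ hinv _ _ heV, heW⟩

lemma mk_p1_ne_mk_p2 :
    Quotient.mk (actSetoid Xq) ⟨((1 : ℂ), (0 : ℂ), (0 : ℂ)), p1_mem⟩
      ≠ Quotient.mk (actSetoid Xq) ⟨((-1 : ℂ), (0 : ℂ), (0 : ℂ)), p2_mem⟩ := by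
  intro h
  obtain ⟨t, ht⟩ := Quotient.exact h
  have h1 := congrArg Prod.fst ht
  norm_num [act] at h1

lemma not_separated_mk_p1_mk_p2 :
    ¬ ∃ O₁ O₂ : Set (Quotient (actSetoid Xq)), IsOpen O₁ ∧ IsOpen O₂ ∧
      Quotient.mk (actSetoid Xq) ⟨((1 : ℂ), (0 : ℂ), (0 : ℂ)), p1_mem⟩ ∈ O₁ ∧
      Quotient.mk (actSetoid Xq) ⟨((-1 : ℂ), (0 : ℂ), (0 : ℂ)), p2_mem⟩ ∈ O₂ ∧
      Disjoint O₁ O₂ := by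
  rintro ⟨O₁, O₂, hO₁, hO₂, h1, h2, hd⟩
  have open_image {O : Set (Quotient (actSetoid Xq))} (hO : IsOpen O) :
      IsOpen (Subtype.val ⁻¹' (Subtype.val '' (Quotient.mk (actSetoid Xq) ⁻¹' O)) : Set ↥Xq) := by
    rw [Set.preimage_image_eq _ Subtype.val_injective]
    exact hO.preimage continuous_quotient_mk'
  obtain ⟨_, ⟨p, hp, rfl⟩, ⟨q, hq, hqp⟩⟩ := inter_nonempty_of_invariant (open_image hO₁)
    (by
      rintro t _ ⟨p, hp, rfl⟩
      refine ⟨⟨act t p, act_mem_Xq p.2 t⟩, ?_, rfl⟩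
      have hmk : Quotient.mk (actSetoid Xq) p =
          Quotient.mk (actSetoid Xq) ⟨act t p, act_mem_Xq p.2 t⟩ := Quotient.sound ⟨t, rfl⟩
      exact Set.mem_preimage.mpr (hmk ▸ Set.mem_preimage.mp hp))
    ⟨_, h1, rfl⟩ (open_image hO₂) ⟨_, h2, rfl⟩
  obtain rfl := Subtype.val_injective hqp
  exact Set.disjoint_left.mp hd hp hq

/-- Every `ℂ`-invariant open subset of `X` containing `(1,0,0)` meets every open subset of `X`
containing `(−1,0,0)`; in particular the orbit space `X/ℂ` is not Hausdorff: the orbits of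
`(1,0,0)` and `(−1,0,0)` are distinct but not separated by disjoint open sets. -/
theorem stmt6 :
    (∀ V : Set (ℂ × ℂ × ℂ), V ⊆ Xq → IsOpen (Subtype.val ⁻¹' V : Set ↥Xq) →
      (∀ t : ℂ, ∀ p ∈ V, act t p ∈ V) → ((1 : ℂ), (0 : ℂ), (0 : ℂ)) ∈ V →
      ∀ W : Set (ℂ × ℂ × ℂ), W ⊆ Xq → IsOpen (Subtype.val ⁻¹' W : Set ↥Xq) →
        ((-1 : ℂ), (0 : ℂ), (0 : ℂ)) ∈ W → (V ∩ W).Nonempty) ∧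
    Quotient.mk (actSetoid Xq) ⟨((1 : ℂ), (0 : ℂ), (0 : ℂ)), p1_mem⟩
      ≠ Quotient.mk (actSetoid Xq) ⟨((-1 : ℂ), (0 : ℂ), (0 : ℂ)), p2_mem⟩ ∧
    (¬ ∃ O₁ O₂ : Set (Quotient (actSetoid Xq)), IsOpen O₁ ∧ IsOpen O₂ ∧
      Quotient.mk (actSetoid Xq) ⟨((1 : ℂ), (0 : ℂ), (0 : ℂ)), p1_mem⟩ ∈ O₁ ∧
      Quotient.mk (actSetoid Xq) ⟨((-1 : ℂ), (0 : ℂ), (0 : ℂ)), p2_mem⟩ ∈ O₂ ∧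
      Disjoint O₁ O₂) ∧
    ¬ T2Space (Quotient (actSetoid Xq)) := by
  exact ⟨fun V _ hV hinv h1 W _ hW h2 => inter_nonempty_of_invariant hV hinv h1 hW h2,
    mk_p1_ne_mk_p2, not_separated_mk_p1_mk_p2,
    fun _ => not_separated_mk_p1_mk_p2 (t2_separation mk_p1_ne_mk_p2)⟩
end

section
/- Let X' = {(x, y, z) ∈ X : z ≠ 0}. The map (x, y, z) ↦ z is ℂ-invariant on X' and induces a homeomorphism from the orbit space X'/ℂ, endowed with the quotient topology, onto ℂ \ {0}. In particular, after removing the fibre over z = 0 the ℂ-action on X admits a Hausdorff (geometric) quotient. -/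
/-- `X' = {p ∈ X : z ≠ 0}`. -/
def Xq' : Set (ℂ × ℂ × ℂ) := {p | p ∈ Xq ∧ p.2.2 ≠ 0}

/-- The point `(0, w⁻¹, w)` of `X'`, a representative of the orbit over `w ≠ 0`. -/
noncomputable def orbitRep (w : {w : ℂ // w ≠ 0}) : ↥Xq' :=
  ⟨(0, (w : ℂ)⁻¹, w), by simp [Xq, w.2], w.2⟩

lemma continuous_orbitRep : Continuous orbitRep :=
  (continuous_const.prodMk
    ((continuous_subtype_val.inv₀ fun w => w.2).prodMk continuous_subtype_val)).subtype_mk _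

/-- The `z`-coordinate on `X'`, as a nonzero complex number. -/
def zCoord (p : ↥Xq') : {w : ℂ // w ≠ 0} := ⟨(p : ℂ × ℂ × ℂ).2.2, p.2.2⟩

lemma continuous_zCoord : Continuous zCoord :=
  continuous_subtype_val.snd.snd.subtype_mk _

lemma zCoord_eq_of_rel (p q : ↥Xq') (h : actSetoid Xq' p q) : zCoord p = zCoord q := by
  obtain ⟨t, ht⟩ := h
  have hz : (act t p).2.2 = (q : ℂ × ℂ × ℂ).2.2 := by rw [ht]
  exact Subtype.ext hz

lemma act_orbitRep_zCoord (p : ↥Xq') :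
    act ((p : ℂ × ℂ × ℂ).1 / (p : ℂ × ℂ × ℂ).2.2) (orbitRep (zCoord p)) = p := by
  obtain ⟨⟨x, y, z⟩, hX, hz⟩ := p
  simp only [Xq, Set.mem_ofPred_eq] at hX hz
  simp only [act, orbitRep, zCoord, Prod.mk.injEq, and_true]
  constructor
  · field_simp
    ring
  · field_simp
    linear_combination -hX

/-- The homeomorphism `X'/ℂ ≃ₜ ℂ \ {0}` induced by the `z`-coordinate. -/
noncomputable def orbitHomeomorph : Quotient (actSetoid Xq') ≃ₜ {w : ℂ // w ≠ 0} where
  toFun := Quotient.lift zCoord zCoord_eq_of_rel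
  invFun w := Quotient.mk _ (orbitRep w)
  left_inv := by
    rintro ⟨p⟩
    exact Quotient.sound ⟨_, act_orbitRep_zCoord p⟩
  right_inv _ := rfl
  continuous_toFun := continuous_zCoord.quotient_lift _
  continuous_invFun := continuous_quotient_mk'.comp continuous_orbitRep

/-- The map `(x, y, z) ↦ z` is `ℂ`-invariant on `X'` and induces a homeomorphism from the
orbit space `X'/ℂ` (with the quotient topology) onto `ℂ \ {0}`. -/
theorem stmt7 :
    (∀ t : ℂ, ∀ p ∈ Xq', (act t p).2.2 = p.2.2) ∧
    ∃ h : Quotient (actSetoid Xq') ≃ₜ {w : ℂ // w ≠ 0},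
      ∀ p : ↥Xq', (h (Quotient.mk (actSetoid Xq') p) : ℂ) = (p : ℂ × ℂ × ℂ).2.2 := by
  exact ⟨fun _ _ _ => rfl, orbitHomeomorph, fun _ => rfl⟩
end

section
/- Let y₀ ∈ ℂ be not rational (y₀ ∉ ℚ). Then there is no γ ∈ SL(2, ℤ) such that γ · M · γ⁻¹ = N, where M = [[1, y₀], [0, −1]] and N = [[−1, y₀], [0, 1]] are complex 2×2 matrices and γ is regarded as a complex matrix via the entrywise inclusion ℤ → ℂ. Equivalently, the points (1, y₀, 0) and (−1, y₀, 0) of the quadric X lie in different SL(2, ℤ)-orbits under the conjugation action. -/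
/-- For `y₀ ∉ ℚ`, no `γ ∈ SL(2, ℤ)` conjugates `[[1, y₀], [0, −1]]` into `[[−1, y₀], [0, 1]]`
(γ regarded as a complex matrix via the entrywise inclusion `ℤ → ℂ`); i.e. the points
`(1, y₀, 0)` and `(−1, y₀, 0)` of the quadric lie in different `SL(2, ℤ)`-orbits. -/
theorem stmt8 (y₀ : ℂ) (hy₀ : y₀ ∉ Set.range ((↑) : ℚ → ℂ)) :
    ¬ ∃ γ : Matrix.SpecialLinearGroup (Fin 2) ℤ,
      ((Matrix.SpecialLinearGroup.map (Int.castRingHom ℂ) γ : Matrix (Fin 2) (Fin 2) ℂ) *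
        !![(1 : ℂ), y₀; 0, -1] *
        (((Matrix.SpecialLinearGroup.map (Int.castRingHom ℂ) γ)⁻¹ :
            Matrix.SpecialLinearGroup (Fin 2) ℂ) : Matrix (Fin 2) (Fin 2) ℂ))
        = !![(-1 : ℂ), y₀; 0, 1] := by
  rintro ⟨γ, h⟩
  set g := Matrix.SpecialLinearGroup.map (Int.castRingHom ℂ) γ with hg
  have hinv : ((g⁻¹ : Matrix.SpecialLinearGroup (Fin 2) ℂ) : Matrix (Fin 2) (Fin 2) ℂ) *
      (g : Matrix (Fin 2) (Fin 2) ℂ) = 1 := by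
    rw [← Matrix.SpecialLinearGroup.coe_mul, inv_mul_cancel, Matrix.SpecialLinearGroup.coe_one]
  have hcomm : (g : Matrix (Fin 2) (Fin 2) ℂ) * !![(1 : ℂ), y₀; 0, -1] =
      !![(-1 : ℂ), y₀; 0, 1] * (g : Matrix (Fin 2) (Fin 2) ℂ) := by
    rw [← h, Matrix.mul_assoc _ _ (g : Matrix (Fin 2) (Fin 2) ℂ), hinv, Matrix.mul_one]
  have hentry : (γ 0 0 : ℂ) = -(γ 0 0 : ℂ) + y₀ * (γ 1 0 : ℂ) := by
    have := congrFun (congrFun hcomm 0) 0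
    simpa [hg, Matrix.mul_apply, Fin.sum_univ_two] using this
  by_cases hc : γ 1 0 = 0
  · have ha : γ 0 0 = 0 := by
      have h2 : (2 : ℂ) * (γ 0 0 : ℂ) = 0 := by
        rw [hc, Int.cast_zero] at hentry
        linear_combination hentry
      simpa using h2
    have hdet := γ.det_coe
    rw [Matrix.det_fin_two, ha, hc] at hdet
    simp at hdet
  · refine hy₀ ⟨2 * (γ 0 0 : ℚ) / (γ 1 0 : ℚ), ?_⟩
    have hc' : (γ 1 0 : ℂ) ≠ 0 := by exact_mod_cast hc
    push_cast
    rw [div_eq_iff hc']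
    linear_combination hentry
end

section
/- Let SL(2, ℤ) act on the quadric X by conjugation. For every SL(2, ℤ)-invariant open subset U ⊆ X whose complement X \ U is countable, the orbit space U/SL(2, ℤ), endowed with the quotient topology, is not Hausdorff. -/
/-- `X`, realised as the set of complex 2×2 matrices of trace 0 and determinant −1. -/
def Xm : Set (Matrix (Fin 2) (Fin 2) ℂ) := {M | M.trace = 0 ∧ M.det = -1}

/-- Conjugation of a complex matrix by an element of `SL(2, ℤ)` (regarded as a complex matrix
via the entrywise inclusion `ℤ → ℂ`). -/
noncomputable def conjAct (γ : Matrix.SpecialLinearGroup (Fin 2) ℤ) (M : Matrix (Fin 2) (Fin 2) ℂ) :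
    Matrix (Fin 2) (Fin 2) ℂ :=
  (Matrix.SpecialLinearGroup.map (Int.castRingHom ℂ) γ : Matrix (Fin 2) (Fin 2) ℂ) * M *
    (((Matrix.SpecialLinearGroup.map (Int.castRingHom ℂ) γ)⁻¹ :
        Matrix.SpecialLinearGroup (Fin 2) ℂ) : Matrix (Fin 2) (Fin 2) ℂ)

lemma conjAct_one (M : Matrix (Fin 2) (Fin 2) ℂ) : conjAct 1 M = M := by
  simp [conjAct]

lemma conjAct_mul (γ₁ γ₂ : Matrix.SpecialLinearGroup (Fin 2) ℤ)
    (M : Matrix (Fin 2) (Fin 2) ℂ) :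
    conjAct (γ₁ * γ₂) M = conjAct γ₁ (conjAct γ₂ M) := by
  simp [conjAct, map_mul, mul_inv_rev, mul_assoc]

/-- The orbit equivalence relation of the conjugation action of `SL(2, ℤ)` on a subset `U`
of the complex 2×2 matrices. -/
def slSetoid (U : Set (Matrix (Fin 2) (Fin 2) ℂ)) : Setoid ↥U where
  r p q := ∃ γ : Matrix.SpecialLinearGroup (Fin 2) ℤ, conjAct γ (p : Matrix (Fin 2) (Fin 2) ℂ) = q
  iseqv := by
    refine ⟨fun p => ⟨1, conjAct_one _⟩, ?_, ?_⟩
    · rintro p q ⟨γ, h⟩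
      exact ⟨γ⁻¹, by rw [← h, ← conjAct_mul, inv_mul_cancel, conjAct_one]⟩
    · rintro p q r ⟨γ₁, h₁⟩ ⟨γ₂, h₂⟩
      exact ⟨γ₂ * γ₁, by rw [conjAct_mul, h₁, h₂]⟩

open Filter Topology

/-- The matrix with eigenvalue `1` on the span of `(p, 1)` and `-1` on the span of `(q, 1)`. -/
noncomputable def eigenMatrix (p q : ℂ) : Matrix (Fin 2) (Fin 2) ℂ :=
  !![(p + q) / (p - q), -2 * p * q / (p - q); 2 / (p - q), -((p + q) / (p - q))]

lemma eigenMatrix_mem_Xm {p q : ℂ} (h : p - q ≠ 0) : eigenMatrix p q ∈ Xm := by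
  constructor
  · simp [eigenMatrix, Matrix.trace_fin_two]
  · simp only [eigenMatrix, Matrix.det_fin_two_of]
    field_simp
    ring

/-- The unipotent element of `SL(2, ℤ)` translating by `n`. -/
def translation (n : ℤ) : Matrix.SpecialLinearGroup (Fin 2) ℤ :=
  ⟨!![1, n; 0, 1], by simp [Matrix.det_fin_two_of]⟩

lemma conjAct_translation_eigenMatrix (n : ℤ) {p q : ℂ} (h : p - q ≠ 0) :
    conjAct (translation n) (eigenMatrix p q) = eigenMatrix (p + n) (q + n) := by
  have h' : p + n - (q + n) = p - q := by ring
  have hmap : (Matrix.SpecialLinearGroup.map (Int.castRingHom ℂ) (translation n) :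
      Matrix (Fin 2) (Fin 2) ℂ) = !![1, (n : ℂ); 0, 1] := by
    change (!![1, n; 0, 1] : Matrix (Fin 2) (Fin 2) ℤ).map (Int.castRingHom ℂ) = _
    ext i j
    fin_cases i <;> fin_cases j <;> simp
  simp only [conjAct, Matrix.SpecialLinearGroup.coe_inv, hmap, eigenMatrix, h']
  ext i j
  fin_cases i <;> fin_cases j <;>
    simp [Matrix.adjugate_fin_two] <;>
    field_simp <;> ring

lemma tendsto_affine_div_affine (a b d : ℂ) :
    Tendsto (fun n : ℕ => (a + b * n) / (d + n)) atTop (𝓝 b) := by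
  have h := ((tendsto_const_div_atTop_nhds_zero_nat a).add_const b).div
    ((tendsto_const_div_atTop_nhds_zero_nat d).add_const 1) (by simp)
  simp only [zero_add, div_one] at h
  refine h.congr' ?_
  filter_upwards [eventually_ne_atTop 0] with n hn
  have hn' : (n : ℂ) ≠ 0 := by exact_mod_cast hn
  simp only [Pi.div_apply]
  rw [← mul_div_mul_right _ _ hn', add_mul, add_mul, div_mul_cancel₀ _ hn',
    div_mul_cancel₀ _ hn', one_mul]

lemma eventually_add_natCast_ne_zero (d : ℂ) : ∀ᶠ n : ℕ in atTop, d + n ≠ 0 := by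
  have h := tendsto_affine_div_affine 1 1 d
  filter_upwards [h.eventually_ne one_ne_zero] with n hn h0
  simp [h0] at hn

lemma tendsto_matrix_fin_two {ι : Type*} {l : Filter ι} {a b c d : ι → ℂ} {a' b' c' d' : ℂ}
    (ha : Tendsto a l (𝓝 a')) (hb : Tendsto b l (𝓝 b'))
    (hc : Tendsto c l (𝓝 c')) (hd : Tendsto d l (𝓝 d')) :
    Tendsto (fun i => !![a i, b i; c i, d i]) l (𝓝 !![a', b'; c', d']) := by
  refine tendsto_pi_nhds.2 fun i => tendsto_pi_nhds.2 fun j => ?_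
  fin_cases i <;> fin_cases j <;> assumption

lemma tendsto_eigenMatrix_left (p q : ℂ) :
    Tendsto (fun n : ℕ => eigenMatrix p (q - n)) atTop (𝓝 !![-1, 2 * p; 0, 1]) := by
  have hx := tendsto_affine_div_affine (p + q) (-1) (p - q)
  have hy := tendsto_affine_div_affine (-2 * p * q) (2 * p) (p - q)
  have hz := tendsto_affine_div_affine 2 0 (p - q)
  convert tendsto_matrix_fin_two hx hy hz hx.neg using 2
  · simp only [eigenMatrix]
    ring_nf
  · simp

lemma tendsto_eigenMatrix_right (p q : ℂ) :
    Tendsto (fun n : ℕ => eigenMatrix (p + n) q) atTop (𝓝 !![1, -2 * q; 0, -1]) := by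
  have hx := tendsto_affine_div_affine (p + q) 1 (p - q)
  have hy := tendsto_affine_div_affine (-2 * p * q) (-2 * q) (p - q)
  have hz := tendsto_affine_div_affine 2 0 (p - q)
  convert tendsto_matrix_fin_two hx hy hz hx.neg using 2
  simp only [eigenMatrix]
  ring_nf

lemma eventually_mem_of_tendsto {U : Set (Matrix (Fin 2) (Fin 2) ℂ)} (hUX : U ⊆ Xm)
    (hopen : IsOpen (Subtype.val ⁻¹' U : Set ↥Xm)) {u : ℕ → Matrix (Fin 2) (Fin 2) ℂ}
    {a : Matrix (Fin 2) (Fin 2) ℂ} (ha : a ∈ U) (hu : Tendsto u atTop (𝓝 a))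
    (huX : ∀ᶠ n in atTop, u n ∈ Xm) : ∀ᶠ n in atTop, u n ∈ U := by
  obtain ⟨V, hV, hVU⟩ := isOpen_induced_iff.1 hopen
  have hiff (x) (hx : x ∈ Xm) : x ∈ V ↔ x ∈ U := Set.ext_iff.1 hVU ⟨x, hx⟩
  filter_upwards [hu.eventually (hV.mem_nhds ((hiff a (hUX ha)).2 ha)), huX] with n h₁ h₂
  exact (hiff _ h₂).1 h₁

lemma exists_tendsto_subtype {α : Type*} [TopologicalSpace α] {U : Set α} {u : ℕ → α} {a : α}
    (ha : a ∈ U) (hu : Tendsto u atTop (𝓝 a)) (huU : ∀ᶠ n in atTop, u n ∈ U) :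
    ∃ f : ℕ → U, Tendsto f atTop (𝓝 ⟨a, ha⟩) ∧ ∀ᶠ n in atTop, (f n : α) = u n := by
  classical
  have hf : ∀ᶠ n in atTop,
      ((if h : u n ∈ U then ⟨u n, h⟩ else ⟨a, ha⟩ : U) : α) = u n := by
    filter_upwards [huU] with n hn
    simp [hn]
  refine ⟨fun n => if h : u n ∈ U then ⟨u n, h⟩ else ⟨a, ha⟩, ?_, hf⟩
  exact tendsto_subtype_rng.2 (hu.congr' (hf.mono fun _ h => h.symm))

lemma exists_apply_notMem_of_countable {α : Type*} {f : ℂ → α} (hf : f.Injective) {S : Set α}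
    (hS : S.Countable) : ∃ p, f p ∉ S := by
  by_contra! h
  have : (f ⁻¹' S).Countable := hS.preimage hf
  rw [Set.eq_univ_of_forall (s := f ⁻¹' S) h] at this
  exact not_countable_complex this


/-- For every `SL(2, ℤ)`-invariant relatively open subset `U ⊆ X` with countable complement
`X \ U`, the orbit space `U/SL(2, ℤ)` with the quotient topology is not Hausdorff. -/
theorem stmt9 (U : Set (Matrix (Fin 2) (Fin 2) ℂ)) (hUX : U ⊆ Xm)
    (hopen : IsOpen (Subtype.val ⁻¹' U : Set ↥Xm))
    (hinv : ∀ γ : Matrix.SpecialLinearGroup (Fin 2) ℤ, ∀ M ∈ U, conjAct γ M ∈ U)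
    (hcount : (Xm \ U).Countable) :
    ¬ T2Space (Quotient (slSetoid U)) := by
  intro hT2
  obtain ⟨q, hq⟩ := exists_apply_notMem_of_countable
    (f := fun q : ℂ => !![1, -2 * q; 0, -1]) (fun a b h => by simpa using h) hcount
  have hQ : !![1, -2 * q; 0, -1] ∈ U := by
    by_contra h
    exact hq ⟨by simp [Xm, Matrix.trace_fin_two, Matrix.det_fin_two_of], h⟩
  have : Countable (Matrix.SpecialLinearGroup (Fin 2) ℤ) :=
    (inferInstance : Countable {A : Fin 2 → Fin 2 → ℤ // Matrix.det A = 1})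
  obtain ⟨p, hp⟩ := exists_apply_notMem_of_countable
    (f := fun p : ℂ => !![-1, 2 * p; 0, 1]) (fun a b h => by simpa using h)
    (hcount.union (Set.countable_range fun γ => conjAct γ !![1, -2 * q; 0, -1]))
  rw [Set.mem_union, not_or] at hp
  have hP : !![-1, 2 * p; 0, 1] ∈ U := by
    by_contra h
    exact hp.1 ⟨by simp [Xm, Matrix.trace_fin_two, Matrix.det_fin_two_of], h⟩
  have hne := eventually_add_natCast_ne_zero (p - q)
  have hPU := eventually_mem_of_tendsto hUX hopen hP (tendsto_eigenMatrix_left p q) <| by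
    filter_upwards [hne] with n hn
    exact eigenMatrix_mem_Xm (by rwa [sub_sub_eq_add_sub, add_sub_right_comm])
  have hQU := eventually_mem_of_tendsto hUX hopen hQ (tendsto_eigenMatrix_right p q) <| by
    filter_upwards [hne] with n hn
    exact eigenMatrix_mem_Xm (by rwa [add_sub_right_comm])
  obtain ⟨f, hf, hfe⟩ := exists_tendsto_subtype hP (tendsto_eigenMatrix_left p q) hPU
  obtain ⟨g, hg, hge⟩ := exists_tendsto_subtype hQ (tendsto_eigenMatrix_right p q) hQU
  have hcont : Continuous (Quotient.mk (slSetoid U)) := continuous_quotient_mk'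
  have hfg : ∀ᶠ n in atTop, Quotient.mk (slSetoid U) (f n) = Quotient.mk (slSetoid U) (g n) := by
    filter_upwards [hne, hfe, hge] with n hn h₁ h₂
    refine Quotient.sound ⟨translation n, ?_⟩
    rw [h₁, h₂, conjAct_translation_eigenMatrix _ (by rwa [sub_sub_eq_add_sub, add_sub_right_comm])]
    simp
  have heq := tendsto_nhds_unique_of_eventuallyEq ((hcont.tendsto _).comp hf)
    ((hcont.tendsto _).comp hg) hfg
  obtain ⟨γ, hγ⟩ := Quotient.exact heq.symm
  exact hp.2 ⟨γ, hγ⟩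
end
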